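/- arXiv:1308.3310 — 3 statements merged into one kernel-verified Lean document; each statement's English description precedes it below -/
import Mathlib

section
/- Let H and G be invertible M×M complex matrices and α ≥ 0 a real number. Then lim_{ρ→∞} [ log det( I_M + ρ^α G G† − ρ^{1+α} G H† (I_M + ρ H H†)⁻¹ H G† ) ] / log ρ = M · (α−1)⁺, where the matrix inside the determinant is Hermitian positive definite for every ρ > 0 (it equals I_M + ρ^α G (I_M + ρ H† H)⁻¹ G†). -/
open Matrix
open scoped ComplexOrder

lemma aux_identity {M : ℕ} (H G : Matrix (Fin M) (Fin M) ℂ) (ρ : ℂ) (hρ : ρ ≠ 0)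
    (hA : IsUnit (1 + ρ • (H * Hᴴ)).det) (hB : IsUnit (ρ⁻¹ • 1 + Hᴴ * H).det) (c : ℂ) :
    1 + c • (G * Gᴴ) - (ρ * c) • (G * Hᴴ * (1 + ρ • (H * Hᴴ))⁻¹ * (H * Gᴴ))
      = 1 + (c * ρ⁻¹) • (G * (ρ⁻¹ • 1 + Hᴴ * H)⁻¹ * Gᴴ) := by
  set A := 1 + ρ • (H * Hᴴ) with hAdef
  set B := ρ⁻¹ • (1 : Matrix (Fin M) (Fin M) ℂ) + Hᴴ * H with hBdef
  have h1 : ρ • (B * Hᴴ) = Hᴴ * A := by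
    rw [hAdef, hBdef]
    simp [add_mul, mul_add, smul_smul, hρ, Matrix.mul_assoc]
  have h2 : B * (ρ • (Hᴴ * A⁻¹ * H)) = B * (1 - ρ⁻¹ • B⁻¹) := by
    rw [Matrix.mul_sub, Matrix.mul_smul, Matrix.mul_smul, Matrix.mul_nonsing_inv _ hB, mul_one,
      ← Matrix.mul_assoc, ← Matrix.mul_assoc, ← Matrix.smul_mul, ← Matrix.smul_mul, h1,
      Matrix.mul_nonsing_inv_cancel_right _ _ hA, hBdef]
    simp
  have h3 : ρ • (Hᴴ * A⁻¹ * H) = 1 - ρ⁻¹ • B⁻¹ := by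
    have := congrArg (fun X => B⁻¹ * X) h2
    simpa only [Matrix.nonsing_inv_mul_cancel_left _ _ hB] using this
  have h4 : (ρ * c) • (G * Hᴴ * A⁻¹ * (H * Gᴴ)) = c • (G * (ρ • (Hᴴ * A⁻¹ * H)) * Gᴴ) := by
    simp only [Matrix.mul_smul, Matrix.smul_mul, smul_smul, Matrix.mul_assoc, mul_comm]
  rw [h4, h3]
  simp only [Matrix.mul_sub, Matrix.sub_mul, Matrix.mul_one, Matrix.mul_smul, Matrix.smul_mul,
    smul_sub, smul_smul]
  abel

lemma aux_rpow (s : ℝ) (hs : 0 ≤ s) :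
    ∃ c : ℝ, 0 ≤ c ∧ (s = 0 → 0 < c) ∧
      Filter.Tendsto (fun ρ : ℝ => ρ ^ (-s)) Filter.atTop (nhds c) := by
  rcases hs.eq_or_lt with h | h
  · refine ⟨1, by norm_num, fun _ => by norm_num, ?_⟩
    subst h
    simp
  · exact ⟨0, le_rfl, fun h' => absurd h' h.ne', tendsto_rpow_neg_atTop h⟩


/-- For invertible `M × M` complex matrices `H`, `G` and `α ≥ 0`,
`lim_{ρ → ∞} log det(I_M + ρ^α G Gᴴ − ρ^{1+α} G Hᴴ (I_M + ρ H Hᴴ)⁻¹ H Gᴴ) / log ρ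
  = M · (α − 1)⁺`. -/
theorem log_det_residual_div_log_tendsto_pos_part_sub_one
    {M : ℕ} (H G : Matrix (Fin M) (Fin M) ℂ)
    (hH : IsUnit H.det) (hG : IsUnit G.det) (α : ℝ) (hα : 0 ≤ α) :
    Filter.Tendsto
      (fun ρ : ℝ =>
        Real.log
          ((1 + ((ρ ^ α : ℝ) : ℂ) • (G * Gᴴ) -
              ((ρ ^ (1 + α) : ℝ) : ℂ) •
                (G * Hᴴ * (1 + (ρ : ℂ) • (H * Hᴴ))⁻¹ * (H * Gᴴ))).det.re) /
          Real.log ρ)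
      Filter.atTop (nhds ((M : ℝ) * max (α - 1) 0)) := by
  classical
  have hHu : IsUnit H := (Matrix.isUnit_iff_isUnit_det _).2 hH
  have hGu : IsUnit G := (Matrix.isUnit_iff_isUnit_det _).2 hG
  have hP : (Hᴴ * H).PosDef :=
    PosDef.conjTranspose_mul_self _ (Matrix.mulVec_injective_iff_isUnit.2 hHu)
  have hQ : (H * Hᴴ).PosDef :=
    PosDef.mul_conjTranspose_self _ (Matrix.vecMul_injective_iff_isUnit.2 hHu)
  have hN : (G * (Hᴴ * H)⁻¹ * Gᴴ).PosDef :=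
    hP.inv.mul_mul_conjTranspose_same (Matrix.vecMul_injective_iff_isUnit.2 hGu)
  set r := max (α - 1) 0 with hr
  obtain ⟨a, ha0, ha1, ha⟩ := aux_rpow r (le_max_right _ _)
  obtain ⟨b, hb0, hb1, hb⟩ := aux_rpow (r - (α - 1)) (sub_nonneg.2 (le_max_left _ _))
  have hL : ((a : ℂ) • (1 : Matrix (Fin M) (Fin M) ℂ)
      + (b : ℂ) • (G * (Hᴴ * H)⁻¹ * Gᴴ)).PosDef := by
    have hac : (0 : ℂ) ≤ (a : ℂ) := by exact_mod_cast ha0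
    have hbc : (0 : ℂ) ≤ (b : ℂ) := by exact_mod_cast hb0
    rcases le_total (α - 1) 0 with h | h
    · have : (0 : ℂ) < (a : ℂ) := by exact_mod_cast ha1 (by rw [hr, max_eq_right h])
      exact (PosDef.one.smul this).add_posSemidef (hN.posSemidef.smul hbc)
    · have : (0 : ℂ) < (b : ℂ) := by exact_mod_cast hb1 (by rw [hr, max_eq_left h, sub_self])
      exact PosDef.posSemidef_add (PosSemidef.one.smul hac) (hN.smul this)
  set L := (a : ℂ) • (1 : Matrix (Fin M) (Fin M) ℂ) + (b : ℂ) • (G * (Hᴴ * H)⁻¹ * Gᴴ) with hLdef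
  let Y : ℝ → Matrix (Fin M) (Fin M) ℂ := fun ρ =>
    ((ρ ^ (-r) : ℝ) : ℂ) • (1 : Matrix (Fin M) (Fin M) ℂ)
      + ((ρ ^ (-(r - (α - 1))) : ℝ) : ℂ) • (G * ((ρ : ℂ)⁻¹ • 1 + Hᴴ * H)⁻¹ * Gᴴ)
  have hBt : Filter.Tendsto (fun ρ : ℝ => (ρ : ℂ)⁻¹ • (1 : Matrix (Fin M) (Fin M) ℂ) + Hᴴ * H)
      Filter.atTop (nhds (Hᴴ * H)) := by
    have h0 : Filter.Tendsto (fun ρ : ℝ => (ρ : ℂ)⁻¹) Filter.atTop (nhds 0) := by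
      have := (Complex.continuous_ofReal.tendsto 0).comp tendsto_inv_atTop_zero
      simpa [Function.comp_def] using this
    have := (h0.smul_const (1 : Matrix (Fin M) (Fin M) ℂ)).add_const (Hᴴ * H)
    simpa using this
  have hPd : (Hᴴ * H).det ≠ 0 := hP.det_pos.ne'
  have hBi : Filter.Tendsto
      (fun ρ : ℝ => ((ρ : ℂ)⁻¹ • (1 : Matrix (Fin M) (Fin M) ℂ) + Hᴴ * H)⁻¹)
      Filter.atTop (nhds (Hᴴ * H)⁻¹) := by
    have hc : ContinuousAt (Inv.inv : Matrix (Fin M) (Fin M) ℂ → _) (Hᴴ * H) := by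
      apply continuousAt_matrix_inv
      rw [Ring.inverse_eq_inv']
      exact continuousAt_inv₀ hPd
    exact hc.tendsto.comp hBt
  have hY : Filter.Tendsto Y Filter.atTop (nhds L) := by
    have ha' := (Complex.continuous_ofReal.tendsto a).comp ha
    have hb' := (Complex.continuous_ofReal.tendsto b).comp hb
    exact (ha'.smul_const _).add (hb'.smul ((hBi.const_mul G).mul_const Gᴴ))
  have hd : Filter.Tendsto (fun ρ => (Y ρ).det.re) Filter.atTop (nhds L.det.re) :=
    ((Complex.continuous_re.comp (continuous_id.matrix_det)).tendsto L).comp hY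
  have hLpos : 0 < L.det.re := (Complex.lt_def.1 hL.det_pos).1
  have hlog : Filter.Tendsto (fun ρ => Real.log (Y ρ).det.re) Filter.atTop
      (nhds (Real.log L.det.re)) := hd.log hLpos.ne'
  have hmain : Filter.Tendsto (fun ρ => (M : ℝ) * r + Real.log (Y ρ).det.re / Real.log ρ)
      Filter.atTop (nhds ((M : ℝ) * r)) := by
    simpa using (hlog.div_atTop Real.tendsto_log_atTop).const_add ((M : ℝ) * r)
  refine hmain.congr' ?_
  filter_upwards [Filter.eventually_gt_atTop 1, hd.eventually (lt_mem_nhds hLpos)] with ρ hρ hpos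
  have hρ0 : 0 < ρ := by linarith
  have hρc : (0 : ℂ) < (ρ : ℂ) := by exact_mod_cast hρ0
  have hρi : (0 : ℂ) < (ρ : ℂ)⁻¹ := by rw [← Complex.ofReal_inv]; exact_mod_cast inv_pos.2 hρ0
  have hA : IsUnit (1 + (ρ : ℂ) • (H * Hᴴ)).det :=
    (PosDef.one.add (hQ.smul hρc)).det_pos.ne'.isUnit
  have hB : IsUnit ((ρ : ℂ)⁻¹ • (1 : Matrix (Fin M) (Fin M) ℂ) + Hᴴ * H).det :=
    ((PosDef.one.smul hρi).add hP).det_pos.ne'.isUnit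
  have hpow : ((ρ ^ (1 + α) : ℝ) : ℂ) = (ρ : ℂ) * ((ρ ^ α : ℝ) : ℂ) := by
    rw [Real.rpow_add hρ0, Real.rpow_one, Complex.ofReal_mul]
  have hX : 1 + ((ρ ^ α : ℝ) : ℂ) • (G * Gᴴ) - ((ρ ^ (1 + α) : ℝ) : ℂ) •
      (G * Hᴴ * (1 + (ρ : ℂ) • (H * Hᴴ))⁻¹ * (H * Gᴴ)) = ((ρ ^ r : ℝ) : ℂ) • Y ρ := by
    rw [hpow, aux_identity H G ρ hρc.ne' hA hB]
    simp only [Y, smul_add, smul_smul, ← Complex.ofReal_mul, ← Complex.ofReal_inv]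
    rw [← Real.rpow_add hρ0, ← Real.rpow_add hρ0, add_neg_cancel, Real.rpow_zero,
      Complex.ofReal_one, one_smul, show r + -(r - (α - 1)) = α - 1 by ring,
      Real.rpow_sub_one hρ0.ne', div_eq_mul_inv]
  have hlogρ : Real.log ρ ≠ 0 := (Real.log_pos hρ).ne'
  rw [hX, Matrix.det_smul, Fintype.card_fin, ← Complex.ofReal_pow, Complex.re_ofReal_mul,
    Real.log_mul (pow_pos (Real.rpow_pos_of_pos hρ0 _) _).ne' hpos.ne', Real.log_pow,
    Real.log_rpow hρ0]
  field_simp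
end

section
/- Let H be an N×M complex matrix and G an N'×M complex matrix, and let P be the M×M matrix of the orthogonal projection onto the kernel of G (i.e., P is Hermitian, P² = P, G P = 0, and P v = v for every v ∈ ℂ^M with G v = 0). Assume that rank(H P) = min{N, (M−N')⁺}. Then lim_{ρ→∞} [ log det( I_N + ρ H H† − ρ² H G† (I_{N'} + ρ G G†)⁻¹ G H† ) ] / log ρ = min{N, (M−N')⁺}, where the matrix inside the determinant is Hermitian positive definite for every ρ > 0. -/
open Matrix
open scoped ComplexOrder

theorem aux_det {m : ℕ} (Q : Matrix (Fin m) (Fin m) ℂ) (hQ : Q.IsHermitian) (ρ : ℝ) :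
    (1 + (ρ : ℂ) • Q).det = ((∏ i, (1 + ρ * hQ.eigenvalues i) : ℝ) : ℂ) := by
  have hs := hQ.spectral_theorem
  set U := hQ.eigenvectorUnitary
  set Dg : Matrix (Fin m) (Fin m) ℂ := diagonal (RCLike.ofReal ∘ hQ.eigenvalues)
  have hU : (U : Matrix (Fin m) (Fin m) ℂ) * star (U : Matrix (Fin m) (Fin m) ℂ) = 1 :=
    Unitary.mul_star_self_of_mem U.2
  have h1 : 1 + (ρ : ℂ) • Q = (U : Matrix (Fin m) (Fin m) ℂ) * (1 + (ρ : ℂ) • Dg) *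
      star (U : Matrix (Fin m) (Fin m) ℂ) := by
    rw [mul_add, add_mul, mul_one, hU]
    conv_lhs => rw [hs]
    simp [Unitary.conjStarAlgAut_apply]
  have h2 : (1 + (ρ : ℂ) • Dg) = diagonal (fun i => ((1 + ρ * hQ.eigenvalues i : ℝ) : ℂ)) := by
    ext i j
    by_cases h : i = j
    · subst h; simp [Dg]
    · simp [Dg, h]
  rw [h1, det_mul, det_mul, mul_right_comm, ← det_mul, hU, det_one, one_mul, h2, det_diagonal]
  push_cast
  rfl

theorem aux_pos {m : ℕ} (Q : Matrix (Fin m) (Fin m) ℂ) (hQ : Q.PosSemidef) (ρ : ℝ) (hρ : 0 ≤ ρ) :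
    0 < ∏ i, (1 + ρ * hQ.1.eigenvalues i) :=
  Finset.prod_pos fun i _ => by
    have := mul_nonneg hρ (hQ.eigenvalues_nonneg i)
    linarith

theorem aux_lim1 (l : ℝ) (hl : 0 ≤ l) :
    Filter.Tendsto (fun ρ : ℝ => Real.log (1 + ρ * l) / Real.log ρ) Filter.atTop
      (nhds (if l ≠ 0 then 1 else 0)) := by
  by_cases h : l = 0
  · simp [h]
  · have hl' : 0 < l := lt_of_le_of_ne hl (Ne.symm h)
    simp only [ne_eq, h, not_false_eq_true, if_true]
    have e : (fun ρ : ℝ => 1 + Real.log (ρ⁻¹ + l) / Real.log ρ) =ᶠ[Filter.atTop]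
        (fun ρ : ℝ => Real.log (1 + ρ * l) / Real.log ρ) := by
      filter_upwards [Filter.eventually_gt_atTop 1] with ρ hρ
      have h0 : 0 < ρ := by linarith
      have hlog := (Real.log_pos hρ).ne'
      have : 1 + ρ * l = ρ * (ρ⁻¹ + l) := by field_simp
      rw [this, Real.log_mul h0.ne' (by positivity)]
      field_simp
    refine Filter.Tendsto.congr' e ?_
    have t1 : Filter.Tendsto (fun ρ : ℝ => Real.log (ρ⁻¹ + l)) Filter.atTop
        (nhds (Real.log (0 + l))) :=
      Filter.Tendsto.log (tendsto_inv_atTop_zero.add_const l) (by simpa using h)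
    simpa using (t1.div_atTop Real.tendsto_log_atTop).const_add 1

theorem aux_lim {m : ℕ} (Q : Matrix (Fin m) (Fin m) ℂ) (hQ : Q.PosSemidef) :
    Filter.Tendsto (fun ρ : ℝ => Real.log ((1 + (ρ : ℂ) • Q).det.re) / Real.log ρ) Filter.atTop
      (nhds (Q.rank : ℝ)) := by
  have e : (fun ρ : ℝ => ∑ i, Real.log (1 + ρ * hQ.1.eigenvalues i) / Real.log ρ)
      =ᶠ[Filter.atTop]
      (fun ρ : ℝ => Real.log ((1 + (ρ : ℂ) • Q).det.re) / Real.log ρ) := by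
    filter_upwards [Filter.eventually_gt_atTop 0] with ρ hρ
    rw [aux_det Q hQ.1, Complex.ofReal_re, Real.log_prod, Finset.sum_div]
    intro i _
    have := mul_nonneg hρ.le (hQ.eigenvalues_nonneg i)
    linarith
  refine Filter.Tendsto.congr' e ?_
  have hr : (Q.rank : ℝ) = ∑ i, (if hQ.1.eigenvalues i ≠ 0 then (1 : ℝ) else 0) := by
    rw [hQ.1.rank_eq_card_non_zero_eigs, Fintype.card_subtype, Finset.sum_boole]
  rw [hr]
  exact tendsto_finsetSum _ fun i _ => aux_lim1 _ (hQ.eigenvalues_nonneg i)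

theorem aux_rank {M N N' : ℕ}
    (H : Matrix (Fin N) (Fin M) ℂ) (G : Matrix (Fin N') (Fin M) ℂ)
    (P : Matrix (Fin M) (Fin M) ℂ) (hGP : G * P = 0)
    (hker : ∀ v : Fin M → ℂ, G.mulVec v = 0 → P.mulVec v = v) :
    (Gᴴ * G + Hᴴ * H).rank = (Gᴴ * G).rank + (H * P).rank := by
  have h1 : Gᴴ * G + Hᴴ * H = (fromRows G H)ᴴ * fromRows G H := by
    rw [conjTranspose_fromRows_eq_fromCols_conjTranspose, fromCols_mul_fromRows]
  rw [h1, rank_conjTranspose_mul_self, rank_conjTranspose_mul_self]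
  have hkS : LinearMap.ker (fromRows G H).mulVecLin =
      LinearMap.ker G.mulVecLin ⊓ LinearMap.ker H.mulVecLin := by
    ext v
    simp only [LinearMap.mem_ker, Submodule.mem_inf, mulVecLin_apply, fromRows_mulVec]
    constructor
    · intro h
      exact ⟨funext fun i => congrFun h (Sum.inl i), funext fun i => congrFun h (Sum.inr i)⟩
    · rintro ⟨ha, hb⟩
      rw [ha, hb]; ext (i | i) <;> rfl
  have hrP : LinearMap.range P.mulVecLin = LinearMap.ker G.mulVecLin := by
    ext v
    simp only [LinearMap.mem_range, LinearMap.mem_ker, mulVecLin_apply]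
    constructor
    · rintro ⟨w, rfl⟩
      rw [mulVec_mulVec, hGP, zero_mulVec]
    · intro h
      exact ⟨v, hker v h⟩
  have hHP : (H * P).rank =
      Module.finrank ℂ (LinearMap.range (H.mulVecLin.domRestrict (LinearMap.ker G.mulVecLin))) := by
    rw [Matrix.rank, mulVecLin_mul, LinearMap.range_comp, hrP, LinearMap.range_domRestrict]
  have n1 := LinearMap.finrank_range_add_finrank_ker (fromRows G H).mulVecLin
  have n2 := LinearMap.finrank_range_add_finrank_ker G.mulVecLin
  have n3 := LinearMap.finrank_range_add_finrank_ker
    (H.mulVecLin.domRestrict (LinearMap.ker G.mulVecLin))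
  rw [← hHP, LinearMap.ker_domRestrict, ← Submodule.finrank_map_subtype_eq,
    Submodule.map_comap_subtype, ← hkS] at n3
  rw [Matrix.rank, Matrix.rank]
  omega

theorem aux_id {M N N' : ℕ}
    (H : Matrix (Fin N) (Fin M) ℂ) (G : Matrix (Fin N') (Fin M) ℂ) (r : ℂ)
    (hE : IsUnit (1 + r • (G * Gᴴ)).det) :
    (1 + r • (Gᴴ * G)).det * (1 + r • (H * Hᴴ) -
      (r ^ 2) • (H * Gᴴ * (1 + r • (G * Gᴴ))⁻¹ * (G * Hᴴ))).det
      = (1 + r • (Gᴴ * G + Hᴴ * H)).det := by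
  set E := 1 + r • (G * Gᴴ) with hEdef
  set D := 1 + r • (Gᴴ * G) with hDdef
  set K : Matrix (Fin M) (Fin M) ℂ := 1 - r • (Gᴴ * E⁻¹ * G) with hK
  have hDG : D * Gᴴ = Gᴴ * E := by
    simp [hEdef, hDdef, Matrix.add_mul, Matrix.mul_add, Matrix.mul_assoc]
  have hDK : D * K = 1 := by
    have : D * (Gᴴ * E⁻¹ * G) = Gᴴ * G := by
      rw [← Matrix.mul_assoc, ← Matrix.mul_assoc, hDG, Matrix.mul_assoc Gᴴ,
        Matrix.mul_nonsing_inv _ hE, Matrix.mul_one]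
    rw [hK, mul_sub, mul_one, mul_smul_comm, this, hDdef]
    simp
  have hA : 1 + r • (H * Hᴴ) - (r ^ 2) • (H * Gᴴ * E⁻¹ * (G * Hᴴ)) = 1 + H * (r • (K * Hᴴ)) := by
    simp only [hK, Matrix.sub_mul, Matrix.mul_sub, Matrix.one_mul, smul_sub, Matrix.smul_mul,
      Matrix.mul_smul, smul_smul, Matrix.mul_assoc, pow_two]
    abel
  rw [hA, det_one_add_mul_comm, ← det_mul, mul_add, mul_one, Matrix.smul_mul, Matrix.mul_smul,
    ← Matrix.mul_assoc, ← Matrix.mul_assoc, hDK, Matrix.one_mul, hDdef, smul_add, add_assoc]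


open Matrix

/-- Let `H : N × M`, `G : N' × M` be complex matrices and `P`
the orthogonal projection onto `ker G`.  If `rank(H P) = min{N, (M − N')⁺}`, then
`lim_{ρ → ∞} log det(I_N + ρ H Hᴴ − ρ² H Gᴴ (I_{N'} + ρ G Gᴴ)⁻¹ G Hᴴ) / log ρ
  = min{N, (M − N')⁺}`. -/
theorem log_det_residual_div_log_tendsto_min_sub
    {M N N' : ℕ}
    (H : Matrix (Fin N) (Fin M) ℂ) (G : Matrix (Fin N') (Fin M) ℂ)
    (P : Matrix (Fin M) (Fin M) ℂ)
    (hPherm : P.IsHermitian) (hPproj : P * P = P) (hGP : G * P = 0)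
    (hker : ∀ v : Fin M → ℂ, G.mulVec v = 0 → P.mulVec v = v)
    (hrank : (H * P).rank = min N (M - N')) :
    Filter.Tendsto
      (fun ρ : ℝ =>
        Real.log
          ((1 + (ρ : ℂ) • (H * Hᴴ) -
              ((ρ ^ 2 : ℝ) : ℂ) •
                (H * Gᴴ * (1 + (ρ : ℂ) • (G * Gᴴ))⁻¹ * (G * Hᴴ))).det.re) /
          Real.log ρ)
      Filter.atTop (nhds ((min N (M - N') : ℕ) : ℝ)) := by
  have hG : (Gᴴ * G).PosSemidef := posSemidef_conjTranspose_mul_self G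
  have hS : (Gᴴ * G + Hᴴ * H).PosSemidef := hG.add (posSemidef_conjTranspose_mul_self H)
  have hG' : (G * Gᴴ).PosSemidef := posSemidef_self_mul_conjTranspose G
  have hl := (aux_lim _ hS).sub (aux_lim _ hG)
  rw [aux_rank H G P hGP hker, hrank, Nat.cast_add, add_sub_cancel_left] at hl
  refine Filter.Tendsto.congr' ?_ hl
  filter_upwards [Filter.eventually_gt_atTop 0] with ρ hρ
  have hE : IsUnit (1 + (ρ : ℂ) • (G * Gᴴ)).det := by
    rw [aux_det _ hG'.1, isUnit_iff_ne_zero]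
    exact_mod_cast (aux_pos _ hG' ρ hρ.le).ne'
  have hid := aux_id H G (ρ : ℂ) hE
  have p1 := aux_pos _ hS ρ hρ.le
  have p2 := aux_pos _ hG ρ hρ.le
  rw [aux_det _ hS.1, aux_det _ hG.1] at hid ⊢
  rw [← sub_div]
  congr 1
  rw [Complex.ofReal_re, Complex.ofReal_re, ← Real.log_div p1.ne' p2.ne']
  congr 1
  have hre := congrArg Complex.re hid
  rw [Complex.re_ofReal_mul, Complex.ofReal_re] at hre
  rw [← hre, mul_div_cancel_left₀ _ p2.ne', Complex.ofReal_pow]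
end

section
/- Let H₁₁, H₁₂, H₂₁ be invertible M×M complex matrices and α ≥ 0 a real number. Then lim_{ρ→∞} [ log det( I_M + ρ H₁₁H₁₁† + ρ^α H₂₁H₂₁† − ρ^{α+1} H₁₁H₁₂† (I_M + ρ^α H₁₂H₁₂†)⁻¹ H₁₂H₁₁† ) ] / log ρ = M · max{(1−α)⁺, α}, where the matrix inside the determinant is Hermitian positive definite for every ρ > 0 (it equals I_M + ρ^α H₂₁H₂₁† + ρ H₁₁(I_M + ρ^α H₁₂†H₁₂)⁻¹H₁₁†). -/
open Matrix
section Helpers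
open scoped ComplexOrder

lemma aux_posdef_smul_add {M : ℕ} (P : Matrix (Fin M) (Fin M) ℂ) (hP : P.PosSemidef)
    {a b : ℝ} (ha : 0 < a) (hb : 0 ≤ b) :
    ((a : ℂ) • (1 : Matrix (Fin M) (Fin M) ℂ) + (b : ℂ) • P).PosDef := by
  have h1 : ((a : ℂ) • (1 : Matrix (Fin M) (Fin M) ℂ)).PosDef :=
    Matrix.PosDef.one.smul (by exact_mod_cast ha)
  exact h1.add_posSemidef (hP.smul (by exact_mod_cast hb))

lemma aux_posdef_self_mul {M : ℕ} (A : Matrix (Fin M) (Fin M) ℂ) (hA : IsUnit A.det) :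
    (A * Aᴴ).PosDef := by
  have hp : (A * Aᴴ).PosSemidef := posSemidef_self_mul_conjTranspose A
  refine hp.posDef_iff_isUnit.2 ?_
  have hA' : IsUnit A := (Matrix.isUnit_iff_isUnit_det A).2 hA
  exact hA'.mul ((Matrix.isUnit_conjTranspose _).2 hA')

lemma aux_identity_s13 {M : ℕ} (C : Matrix (Fin M) (Fin M) ℂ) {t : ℝ} (ht : 0 < t) :
    (t : ℂ) • (Cᴴ * (1 + (t : ℂ) • (C * Cᴴ))⁻¹ * C) =
      1 - ((t⁻¹ : ℝ) : ℂ) • (((t⁻¹ : ℝ) : ℂ) • 1 + Cᴴ * C)⁻¹ := by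
  have hX : IsUnit (1 + (t : ℂ) • (C * Cᴴ)).det := by
    have := (aux_posdef_smul_add _ (posSemidef_self_mul_conjTranspose C) one_pos ht.le).isUnit
    simp only [Complex.ofReal_one, one_smul] at this
    exact (Matrix.isUnit_iff_isUnit_det _).1 this
  have hZ : IsUnit (((t⁻¹ : ℝ) : ℂ) • 1 + Cᴴ * C).det := by
    have := (aux_posdef_smul_add _ (posSemidef_conjTranspose_mul_self C)
      (inv_pos.2 ht) zero_le_one).isUnit
    simp only [Complex.ofReal_one, one_smul] at this
    exact (Matrix.isUnit_iff_isUnit_det _).1 this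
  set X := 1 + (t : ℂ) • (C * Cᴴ) with hXd
  set Z := ((t⁻¹ : ℝ) : ℂ) • 1 + Cᴴ * C with hZd
  have ht' : (t : ℂ) ≠ 0 := by exact_mod_cast ht.ne'
  have h1 : (t : ℂ) • (C * Z) = X * C := by
    rw [hXd, hZd]
    simp [mul_add, add_mul, smul_smul, ht', mul_assoc]
  have h2 : (t : ℂ) • (X⁻¹ * C) = C * Z⁻¹ := by
    calc (t : ℂ) • (X⁻¹ * C) = (t : ℂ) • (X⁻¹ * C * (Z * Z⁻¹)) := by
          rw [Matrix.mul_nonsing_inv _ hZ, mul_one]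
      _ = X⁻¹ * ((t : ℂ) • (C * Z)) * Z⁻¹ := by simp [mul_assoc]
      _ = (X⁻¹ * X) * C * Z⁻¹ := by rw [h1]; simp [mul_assoc]
      _ = C * Z⁻¹ := by rw [Matrix.nonsing_inv_mul _ hX, one_mul]
  have h3 : Cᴴ * C = Z - ((t⁻¹ : ℝ) : ℂ) • 1 := by rw [hZd]; abel
  calc (t : ℂ) • (Cᴴ * X⁻¹ * C) = Cᴴ * ((t : ℂ) • (X⁻¹ * C)) := by simp [mul_assoc]
    _ = (Cᴴ * C) * Z⁻¹ := by rw [h2, mul_assoc]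
    _ = _ := by rw [h3, sub_mul, Matrix.mul_nonsing_inv _ hZ]; simp

lemma aux_rpow_tendsto (e : ℝ) (he : e ≤ 0) :
    Filter.Tendsto (fun ρ : ℝ => ((ρ ^ e : ℝ) : ℂ)) Filter.atTop
      (nhds (((if e = 0 then 1 else 0 : ℝ)) : ℂ)) := by
  refine (Complex.continuous_ofReal.tendsto _).comp ?_
  split_ifs with h
  · simp [h]
  · have := tendsto_rpow_neg_atTop (y := -e) (by have := lt_of_le_of_ne he h; linarith)
    simpa using this

end Helpers

open scoped ComplexOrder in
/-- For invertible `M × M` complex matrices `H₁₁, H₁₂, H₂₁` and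
`α ≥ 0`,
`lim_{ρ → ∞} log det(I_M + ρ H₁₁H₁₁ᴴ + ρ^α H₂₁H₂₁ᴴ
  − ρ^{α+1} H₁₁H₁₂ᴴ (I_M + ρ^α H₁₂H₁₂ᴴ)⁻¹ H₁₂H₁₁ᴴ) / log ρ
  = M · max{(1 − α)⁺, α}`. -/
theorem log_det_three_matrix_div_log_tendsto
    {M : ℕ} (H₁₁ H₁₂ H₂₁ : Matrix (Fin M) (Fin M) ℂ)
    (h₁₁ : IsUnit H₁₁.det) (h₁₂ : IsUnit H₁₂.det) (h₂₁ : IsUnit H₂₁.det)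
    (α : ℝ) (hα : 0 ≤ α) :
    Filter.Tendsto
      (fun ρ : ℝ =>
        Real.log
          ((1 + (ρ : ℂ) • (H₁₁ * H₁₁ᴴ) + ((ρ ^ α : ℝ) : ℂ) • (H₂₁ * H₂₁ᴴ) -
              ((ρ ^ (α + 1) : ℝ) : ℂ) •
                (H₁₁ * H₁₂ᴴ * (1 + ((ρ ^ α : ℝ) : ℂ) • (H₁₂ * H₁₂ᴴ))⁻¹ *
                  (H₁₂ * H₁₁ᴴ))).det.re) /
          Real.log ρ)
      Filter.atTop (nhds ((M : ℝ) * max (max (1 - α) 0) α)) := by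
  obtain ⟨β, hβ⟩ : ∃ β, β = max (max (1 - α) 0) α := ⟨_, rfl⟩
  rw [← hβ]
  have hβ1 : 1 - α ≤ β := by rw [hβ]; simp
  have hβ2 : α ≤ β := by rw [hβ]; simp
  have hβ3 : 0 ≤ β := hα.trans hβ2
  have hβ4 : 1 - α - β = 0 ∨ α - β = 0 := by
    by_contra! h
    have e1 : 1 - α < β := lt_of_le_of_ne hβ1 (fun h' => h.1 (by linarith))
    have e2 : α < β := lt_of_le_of_ne hβ2 (fun h' => h.2 (by linarith))
    have : β < β := by
      conv_lhs => rw [hβ]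
      exact max_lt (max_lt e1 (by linarith)) e2
    exact lt_irrefl _ this
  let D : ℂ → ℂ → ℂ → ℂ → Matrix (Fin M) (Fin M) ℂ := fun a b c s =>
    a • 1 + b • (H₂₁ * H₂₁ᴴ) + c • (H₁₁ * (s • 1 + H₁₂ᴴ * H₁₂)⁻¹ * H₁₁ᴴ)
  let l : ℝ → ℝ := fun e => if e = 0 then 1 else 0
  have hl : ∀ e, 0 ≤ l e := fun e => by simp only [l]; split_ifs <;> norm_num
  have hQ : (H₁₂ᴴ * H₁₂).PosDef := by
    have := aux_posdef_self_mul H₁₂ᴴ (by rw [Matrix.det_conjTranspose]; exact h₁₂.star)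
    simpa using this
  have hZ : (((l (-α) : ℝ) : ℂ) • (1 : Matrix (Fin M) (Fin M) ℂ) + H₁₂ᴴ * H₁₂).PosDef :=
    hQ.posSemidef_add (Matrix.PosSemidef.one.smul (by exact_mod_cast hl _))
  have hN : (H₁₁ * (((l (-α) : ℝ) : ℂ) • (1 : Matrix (Fin M) (Fin M) ℂ) + H₁₂ᴴ * H₁₂)⁻¹
      * H₁₁ᴴ).PosDef := by
    have hp := hZ.inv.posSemidef.mul_mul_conjTranspose_same H₁₁
    refine hp.posDef_iff_isUnit.2 ?_
    have hA' : IsUnit H₁₁ := (Matrix.isUnit_iff_isUnit_det _).2 h₁₁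
    exact (hA'.mul hZ.inv.isUnit).mul ((Matrix.isUnit_conjTranspose _).2 hA')
  have hB : (H₂₁ * H₂₁ᴴ).PosDef := aux_posdef_self_mul _ h₂₁
  have hL : (D (l (-β)) (l (α - β)) (l (1 - α - β)) (l (-α))).PosDef := by
    have p1 : (((l (-β) : ℝ) : ℂ) • (1 : Matrix (Fin M) (Fin M) ℂ)).PosSemidef :=
      Matrix.PosSemidef.one.smul (by exact_mod_cast hl _)
    have p2 := hB.posSemidef.smul (a := ((l (α - β) : ℝ) : ℂ)) (by exact_mod_cast hl _)
    have p3 := hN.posSemidef.smul (a := ((l (1 - α - β) : ℝ) : ℂ)) (by exact_mod_cast hl _)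
    rcases hβ4 with h | h
    · have : l (1 - α - β) = 1 := by simp [l, h]
      refine Matrix.PosDef.posSemidef_add (p1.add p2) ?_
      rw [this]; simpa using hN
    · have : l (α - β) = 1 := by simp [l, h]
      refine Matrix.PosDef.add_posSemidef (Matrix.PosDef.posSemidef_add p1 ?_) p3
      rw [this]; simpa using hB
  have t1 := aux_rpow_tendsto (-β) (by linarith)
  have t2 := aux_rpow_tendsto (α - β) (by linarith)
  have t3 := aux_rpow_tendsto (1 - α - β) (by linarith)
  have t4 := aux_rpow_tendsto (-α) (by linarith)
  have tZ : Filter.Tendsto (fun ρ : ℝ => (((ρ ^ (-α) : ℝ) : ℂ) • (1 : Matrix (Fin M) (Fin M) ℂ)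
      + H₁₂ᴴ * H₁₂)⁻¹) Filter.atTop
      (nhds (((l (-α) : ℝ) : ℂ) • (1 : Matrix (Fin M) (Fin M) ℂ) + H₁₂ᴴ * H₁₂)⁻¹) := by
    have t5 := (t4.smul_const (1 : Matrix (Fin M) (Fin M) ℂ)).add_const (H₁₂ᴴ * H₁₂)
    simp only [Matrix.inv_def, Ring.inverse_eq_inv']
    refine Filter.Tendsto.smul ?_ ?_
    · exact (((continuous_id.matrix_det).tendsto _).comp t5).inv₀
        ((Matrix.isUnit_iff_isUnit_det _).1 hZ.isUnit).ne_zero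
    · exact ((continuous_id.matrix_adjugate).tendsto _).comp t5
  have tD : Filter.Tendsto (fun ρ : ℝ => D ((ρ ^ (-β) : ℝ) : ℂ) ((ρ ^ (α - β) : ℝ) : ℂ)
      ((ρ ^ (1 - α - β) : ℝ) : ℂ) ((ρ ^ (-α) : ℝ) : ℂ)) Filter.atTop
      (nhds (D (l (-β)) (l (α - β)) (l (1 - α - β)) (l (-α)))) := by
    refine ((t1.smul_const _).add (t2.smul_const _)).add (t3.smul ?_)
    exact (tZ.const_mul H₁₁).mul_const H₁₁ᴴ
  have hre := (Complex.pos_iff.1 hL.det_pos).1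
  have tR := ((Complex.continuous_re.tendsto _).comp
    (((continuous_id.matrix_det).tendsto _).comp tD))
  have tlog := tR.log hre.ne'
  have tdiv := (tlog.div_atTop Real.tendsto_log_atTop).const_add ((M : ℝ) * β)
  rw [add_zero] at tdiv
  refine tdiv.congr' ?_
  filter_upwards [Filter.eventually_gt_atTop 1, tR.eventually (lt_mem_nhds hre)] with ρ hρ hpos
  have hρ0 : 0 < ρ := by linarith
  have hlog : Real.log ρ ≠ 0 := (Real.log_pos hρ).ne'
  simp only [Function.comp, id] at hpos ⊢
  have key : (1 + (ρ : ℂ) • (H₁₁ * H₁₁ᴴ) + ((ρ ^ α : ℝ) : ℂ) • (H₂₁ * H₂₁ᴴ) -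
              ((ρ ^ (α + 1) : ℝ) : ℂ) •
                (H₁₁ * H₁₂ᴴ * (1 + ((ρ ^ α : ℝ) : ℂ) • (H₁₂ * H₁₂ᴴ))⁻¹ *
                  (H₁₂ * H₁₁ᴴ))) = ((ρ ^ β : ℝ) : ℂ) • D ((ρ ^ (-β) : ℝ) : ℂ)
      ((ρ ^ (α - β) : ℝ) : ℂ) ((ρ ^ (1 - α - β) : ℝ) : ℂ) ((ρ ^ (-α) : ℝ) : ℂ) := by
    have hid := aux_identity_s13 H₁₂ (Real.rpow_pos_of_pos hρ0 α)
    rw [← Real.rpow_neg hρ0.le] at hid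
    have e0 : ((ρ ^ β : ℝ) : ℂ) * ((ρ ^ (-β) : ℝ) : ℂ) = 1 := by
      rw [← Complex.ofReal_mul, ← Real.rpow_add hρ0]; simp
    have e1 : ((ρ ^ β : ℝ) : ℂ) * ((ρ ^ (α - β) : ℝ) : ℂ) = ((ρ ^ α : ℝ) : ℂ) := by
      rw [← Complex.ofReal_mul, ← Real.rpow_add hρ0]; congr 2; ring
    have e2 : ((ρ ^ β : ℝ) : ℂ) * ((ρ ^ (1 - α - β) : ℝ) : ℂ) =
        (ρ : ℂ) * ((ρ ^ (-α) : ℝ) : ℂ) := by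
      rw [← Complex.ofReal_mul, ← Complex.ofReal_mul, ← Real.rpow_add hρ0]
      congr 1
      nth_rewrite 2 [← Real.rpow_one ρ]
      rw [← Real.rpow_add hρ0]; congr 1; ring
    have e3 : ((ρ ^ (α + 1) : ℝ) : ℂ) = (ρ : ℂ) * ((ρ ^ α : ℝ) : ℂ) := by
      rw [Real.rpow_add hρ0, Real.rpow_one]; push_cast; ring
    have e4 : ((ρ ^ (α + 1) : ℝ) : ℂ) •
                (H₁₁ * H₁₂ᴴ * (1 + ((ρ ^ α : ℝ) : ℂ) • (H₁₂ * H₁₂ᴴ))⁻¹ *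
                  (H₁₂ * H₁₁ᴴ)) = (ρ : ℂ) • (H₁₁ * (((ρ ^ α : ℝ) : ℂ) •
                  (H₁₂ᴴ * (1 + ((ρ ^ α : ℝ) : ℂ) • (H₁₂ * H₁₂ᴴ))⁻¹ * H₁₂)) * H₁₁ᴴ) := by
      rw [e3]; simp only [mul_assoc, smul_smul, Matrix.mul_smul, Matrix.smul_mul]
    rw [e4, hid]
    simp only [D, smul_add, smul_smul, e0, e1, e2, one_smul, mul_sub, sub_mul, mul_one, smul_sub,
      Matrix.mul_smul, Matrix.smul_mul]
    abel
  rw [key, Matrix.det_smul, ← Complex.ofReal_pow, Complex.re_ofReal_mul,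
    Real.log_mul (pow_pos (Real.rpow_pos_of_pos hρ0 β) _).ne' hpos.ne', Real.log_pow,
    Real.log_rpow hρ0, Fintype.card_fin]
  field_simp
end
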